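/- arXiv:2303.05945 — 2 statements merged into one kernel-verified Lean document; each statement's English description precedes it below -/
import Mathlib

section
/- The transformed diffusion coefficient σ̃ = G' ∘ G⁻¹, i.e., the function σ̃(x) = G'(G⁻¹(x)), is Lipschitz continuous on ℝ. -/
open Filter Set

/-- The bump function `φ(u) = (1+u)³(1−u)³` for `|u| ≤ 1` and `φ(u) = 0` otherwise. -/
noncomputable def phi (u : ℝ) : ℝ := if |u| ≤ 1 then (1 + u) ^ 3 * (1 - u) ^ 3 else 0

/-- The transformation `G(x) = x + Σ_{j=1}^k α_j φ((x−ζ_j)/c)(x−ζ_j)|x−ζ_j|`. -/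
noncomputable def Gfun (k : ℕ) (ζ α : Fin k → ℝ) (c : ℝ) (x : ℝ) : ℝ :=
  x + ∑ j : Fin k, α j * (phi ((x - ζ j) / c) * ((x - ζ j) * |x - ζ j|))

/-- The derivative of `u ↦ φ(u) u |u|`, written as a polynomial in `min |u| 1`. -/
noncomputable def phiDeriv (u : ℝ) : ℝ :=
  2 * min |u| 1 * (1 - min |u| 1 ^ 2) ^ 2 * (1 - 4 * min |u| 1 ^ 2)

theorem hasDerivAt_mul_abs (x : ℝ) : HasDerivAt (fun t : ℝ => t * |t|) (2 * |x|) x := by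
  rcases eq_or_ne x 0 with rfl | hx
  · rw [hasDerivAt_iff_tendsto_slope]
    have h : Tendsto (fun t : ℝ => |t|) (nhdsWithin 0 {0}ᶜ) (nhds (2 * |(0 : ℝ)|)) := by
      have := (continuous_abs.tendsto (0 : ℝ)).mono_left
        (nhdsWithin_le_nhds (s := ({0}ᶜ : Set ℝ)))
      simpa using this
    refine h.congr' ?_
    filter_upwards [self_mem_nhdsWithin] with t ht
    have ht' : t ≠ 0 := ht
    simp [slope_def_field, ht']
  · refine ((hasDerivAt_id x).mul (hasDerivAt_abs hx)).congr_deriv ?_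
    rcases lt_or_gt_of_ne hx with h | h
    · simp [abs_of_neg h, sign_neg h]; ring
    · simp [abs_of_pos h, sign_pos h]; ring

theorem hasDerivAt_max_zero_pow_three (t : ℝ) :
    HasDerivAt (fun s : ℝ => max 0 s ^ 3) (3 * max 0 t ^ 2) t := by
  have hfun : (fun s : ℝ => max 0 s ^ 3) = fun s => (s ^ 3 + s * (s * |s|)) / 2 := by
    funext s
    rcases le_total 0 s with h | h
    · rw [max_eq_right h, abs_of_nonneg h]; ring
    · rw [max_eq_left h, abs_of_nonpos h]; ring
  rw [hfun]
  refine (((hasDerivAt_pow 3 t).add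
    ((hasDerivAt_id t).mul (hasDerivAt_mul_abs t))).div_const 2).congr_deriv ?_
  rcases le_total 0 t with h | h
  · rw [max_eq_right h, abs_of_nonneg h]; simp; ring
  · rw [max_eq_left h, abs_of_nonpos h]; simp; ring

theorem phi_eq_max_pow (u : ℝ) : phi u = max 0 (1 - u ^ 2) ^ 3 := by
  unfold phi
  split_ifs with h
  · rw [max_eq_right (by nlinarith [(sq_le_one_iff_abs_le_one u).2 h])]; ring
  · rw [max_eq_left (by nlinarith [(one_lt_sq_iff_one_lt_abs u).2 (not_le.1 h)])]; simp

theorem hasDerivAt_phi (u : ℝ) :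
    HasDerivAt phi (-6 * u * max 0 (1 - u ^ 2) ^ 2) u := by
  rw [funext phi_eq_max_pow]
  refine ((hasDerivAt_max_zero_pow_three (1 - u ^ 2)).comp u
    ((hasDerivAt_pow 2 u).const_sub 1)).congr_deriv ?_
  simp; ring

theorem phiDeriv_eq (u : ℝ) :
    phiDeriv u = -6 * u * max 0 (1 - u ^ 2) ^ 2 * (u * |u|) + phi u * (2 * |u|) := by
  rw [phi_eq_max_pow]
  unfold phiDeriv
  rcases le_total |u| 1 with h | h
  · rw [min_eq_left h, sq_abs,
      max_eq_right (by nlinarith [(sq_le_one_iff_abs_le_one u).2 h])]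
    ring
  · rw [min_eq_right h, max_eq_left (by nlinarith [(one_le_sq_iff_one_le_abs u).2 h])]
    norm_num

theorem phiDeriv_eq_zero {u : ℝ} (h : 1 ≤ |u|) : phiDeriv u = 0 := by
  simp [phiDeriv, min_eq_right h]

theorem abs_phiDeriv_le (u : ℝ) : |phiDeriv u| ≤ 2 := by
  unfold phiDeriv
  have h0 : 0 ≤ min |u| 1 := le_min (abs_nonneg u) zero_le_one
  have h1 : min |u| 1 ≤ 1 := min_le_right _ _
  generalize min |u| 1 = w at h0 h1
  have hs1 : w ^ 2 ≤ 1 := pow_le_one₀ h0 h1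
  have hs0 : 0 ≤ w ^ 2 := sq_nonneg w
  have hb : |(1 - w ^ 2) ^ 2 * (1 - 4 * w ^ 2)| ≤ 1 := by
    generalize w ^ 2 = s at hs1 hs0
    have hm : (1 - s) ^ 2 ≤ 1 := pow_le_one₀ (by linarith) (by linarith)
    have hsm : 4 * s * (1 - s) ≤ 1 := by nlinarith [sq_nonneg (2 * s - 1)]
    rw [abs_le]
    constructor
    · nlinarith [mul_le_mul_of_nonneg_right hsm (sub_nonneg.2 hs1), sq_nonneg (1 - s)]
    · nlinarith [mul_nonneg hs0 (sq_nonneg (1 - s))]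
  rw [mul_assoc, abs_mul, abs_of_nonneg (by linarith : 0 ≤ 2 * w)]
  nlinarith [abs_nonneg ((1 - w ^ 2) ^ 2 * (1 - 4 * w ^ 2))]

theorem exists_lipschitzWith_phiDeriv : ∃ K : NNReal, LipschitzWith K phiDeriv := by
  have hp : ContDiff ℝ 1 (fun w : ℝ => 2 * w * (1 - w ^ 2) ^ 2 * (1 - 4 * w ^ 2)) := by
    fun_prop
  obtain ⟨K, hK⟩ := hp.contDiffOn.exists_lipschitzOnWith one_ne_zero
    (convex_Icc (0 : ℝ) 1) isCompact_Icc
  have hmin : LipschitzWith 1 (fun u : ℝ => min |u| 1) :=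
    (LipschitzWith.of_dist_le_mul fun x y => by
      simpa [Real.dist_eq] using abs_abs_sub_abs_le_abs_sub x y : LipschitzWith 1
        (fun u : ℝ => |u|)).min_const 1
  refine ⟨K * 1, ?_⟩
  rw [← lipschitzOnWith_univ]
  exact hK.comp (hmin.lipschitzOnWith (s := univ)) fun u _ =>
    ⟨le_min (abs_nonneg u) zero_le_one, min_le_right _ _⟩

theorem hasDerivAt_Gfun (k : ℕ) (ζ α : Fin k → ℝ) {c : ℝ} (hc : 0 < c) (x : ℝ) :
    HasDerivAt (Gfun k ζ α c) (1 + ∑ j, α j * c * phiDeriv ((x - ζ j) / c)) x := by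
  refine (hasDerivAt_id x).add (HasDerivAt.fun_sum fun j _ => ?_)
  have hsub : HasDerivAt (fun y : ℝ => y - ζ j) 1 x := (hasDerivAt_id x).sub_const _
  have hphi := (hasDerivAt_phi ((x - ζ j) / c)).comp x (hsub.div_const c)
  have habs := (hasDerivAt_mul_abs (x - ζ j)).comp x hsub
  refine ((hphi.mul habs).const_mul (α j)).congr_deriv ?_
  rw [phiDeriv_eq]
  have hx : x - ζ j = c * ((x - ζ j) / c) := by field_simp
  simp only [Function.comp_apply]
  generalize (x - ζ j) / c = u at hx
  rw [hx, abs_mul, abs_of_pos hc]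
  field_simp

theorem exists_lipschitzWith_deriv_Gfun (k : ℕ) (ζ α : Fin k → ℝ) {c : ℝ} (hc : 0 < c) :
    ∃ K : NNReal, LipschitzWith K (deriv (Gfun k ζ α c)) := by
  obtain ⟨K, hK⟩ := exists_lipschitzWith_phiDeriv
  refine ⟨∑ j, ‖α j‖₊ * K, LipschitzWith.of_dist_le_mul fun x y => ?_⟩
  rw [(hasDerivAt_Gfun k ζ α hc x).deriv, (hasDerivAt_Gfun k ζ α hc y).deriv, dist_add_left,
    NNReal.coe_sum, Finset.sum_mul]
  refine (dist_sum_sum_le_of_le _ fun j _ => ?_)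
  have h := hK.dist_le_mul ((x - ζ j) / c) ((y - ζ j) / c)
  have hd : dist ((x - ζ j) / c) ((y - ζ j) / c) = dist x y / c := by
    rw [Real.dist_eq, Real.dist_eq, ← sub_div, abs_div, abs_of_pos hc, sub_sub_sub_cancel_right]
  rw [hd] at h
  rw [Real.dist_eq, ← mul_sub, abs_mul, abs_mul, abs_of_pos hc, ← Real.dist_eq]
  calc |α j| * c * dist (phiDeriv ((x - ζ j) / c)) (phiDeriv ((y - ζ j) / c))
      ≤ |α j| * c * (K * (dist x y / c)) := by gcongr
    _ = (‖α j‖₊ * K : NNReal) * dist x y := by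
      push_cast
      rw [Real.norm_eq_abs]
      field_simp

theorem two_mul_lt_sub_of_lt {k : ℕ} {ζ : Fin k → ℝ} (hζ : StrictMono ζ) {c : ℝ}
    (hsep : ∀ (j : ℕ) (h : j + 1 < k) (h' : j < k), c < (ζ ⟨j + 1, h⟩ - ζ ⟨j, h'⟩) / 2)
    {i j : Fin k} (hij : i < j) : 2 * c < ζ j - ζ i := by
  have hi : (i : ℕ) + 1 < k := lt_of_le_of_lt (Nat.succ_le_of_lt hij) j.isLt
  have h1 := hsep i hi i.isLt
  have h2 : ζ ⟨i + 1, hi⟩ ≤ ζ j := hζ.monotone (Nat.succ_le_of_lt hij)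
  have h3 : ζ ⟨i, i.isLt⟩ = ζ i := rfl
  linarith

theorem two_thirds_le_deriv_Gfun {k : ℕ} {ζ α : Fin k → ℝ} {c : ℝ}
    (hc : 0 < c) (hα : ∀ j : Fin k, α j ≠ 0 → c < 1 / (6 * |α j|))
    (hsep : ∀ i j : Fin k, i < j → 2 * c < ζ j - ζ i) (x : ℝ) :
    2 / 3 ≤ deriv (Gfun k ζ α c) x := by
  rw [(hasDerivAt_Gfun k ζ α hc x).deriv]
  by_cases hx : ∃ i, |x - ζ i| < c
  · obtain ⟨i, hi⟩ := hx
    rw [Finset.sum_eq_single_of_mem i (Finset.mem_univ i)]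
    · have hαc : |α i * c| ≤ 1 / 6 := by
        rw [abs_mul, abs_of_pos hc]
        by_cases h0 : α i = 0
        · simp [h0]
        · have h := hα i h0
          have hpos : 0 < |α i| := abs_pos.2 h0
          rw [lt_div_iff₀ (by positivity)] at h
          linarith
      have hbd : |α i * c * phiDeriv ((x - ζ i) / c)| ≤ 1 / 6 * 2 := by
        rw [abs_mul]
        exact mul_le_mul hαc (abs_phiDeriv_le _) (abs_nonneg _) (by norm_num)
      linarith [(abs_le.1 hbd).1]
    · intro j _ hji
      rw [phiDeriv_eq_zero, mul_zero]
      rw [abs_div, abs_of_pos hc, one_le_div hc]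
      rw [abs_lt] at hi
      rcases lt_or_gt_of_ne hji with h | h
      · linarith [hsep _ _ h, le_abs_self (x - ζ j)]
      · linarith [hsep _ _ h, neg_le_abs (x - ζ j)]
  · push Not at hx
    rw [Finset.sum_eq_zero]
    · norm_num
    · intro j _
      rw [phiDeriv_eq_zero, mul_zero]
      rw [abs_div, abs_of_pos hc, one_le_div hc]
      exact hx j

theorem antilipschitzWith_Gfun {k : ℕ} {ζ α : Fin k → ℝ} {c : ℝ}
    (hc : 0 < c) (hα : ∀ j : Fin k, α j ≠ 0 → c < 1 / (6 * |α j|))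
    (hsep : ∀ i j : Fin k, i < j → 2 * c < ζ j - ζ i) :
    AntilipschitzWith (3 / 2) (Gfun k ζ α c) := by
  have hdiff : Differentiable ℝ (Gfun k ζ α c) := fun x =>
    (hasDerivAt_Gfun k ζ α hc x).differentiableAt
  have hmain := mul_sub_le_image_sub_of_le_deriv hdiff (two_thirds_le_deriv_Gfun hc hα hsep)
  refine AntilipschitzWith.of_le_mul_dist fun x y => ?_
  rw [Real.dist_eq, Real.dist_eq]
  push_cast
  rcases le_total x y with h | h
  · rw [abs_sub_comm x, abs_of_nonneg (sub_nonneg.2 h), abs_sub_comm]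
    linarith [hmain h, le_abs_self (Gfun k ζ α c y - Gfun k ζ α c x)]
  · rw [abs_of_nonneg (sub_nonneg.2 h)]
    linarith [hmain h, le_abs_self (Gfun k ζ α c x - Gfun k ζ α c y)]

/-- The transformed diffusion coefficient `σ̃ = G' ∘ G⁻¹` is Lipschitz continuous on `ℝ`. -/
theorem stmt14 (k : ℕ) (ζ α : Fin k → ℝ) (hζ : StrictMono ζ) (c : ℝ) (hc : 0 < c)
    (hα : ∀ j : Fin k, α j ≠ 0 → c < 1 / (6 * |α j|))
    (hsep : ∀ (j : ℕ) (h : j + 1 < k), c < (ζ ⟨j + 1, h⟩ - ζ ⟨j, by omega⟩) / 2)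
    (Ginv : ℝ → ℝ) (hGinv₁ : Function.LeftInverse Ginv (Gfun k ζ α c))
    (hGinv₂ : Function.RightInverse Ginv (Gfun k ζ α c)) :
    ∃ K : NNReal, LipschitzWith K (fun x : ℝ => deriv (Gfun k ζ α c) (Ginv x)) := by
  obtain ⟨K, hK⟩ := exists_lipschitzWith_deriv_Gfun k ζ α hc
  have hgap : ∀ i j : Fin k, i < j → 2 * c < ζ j - ζ i := fun _ _ =>
    two_mul_lt_sub_of_lt hζ fun j h _ => hsep j h
  exact ⟨K * (3 / 2),
    hK.comp ((antilipschitzWith_Gfun hc hα hgap).to_rightInverse hGinv₂)⟩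
end

section
/- The transformed jump coefficient ρ̃ defined by ρ̃(x) = G(G⁻¹(x) + 1) − x is Lipschitz continuous on ℝ. -/
open Filter Set

theorem hasDerivAt_mul_abs_self (t : ℝ) : HasDerivAt (fun x : ℝ => x * |x|) (2 * |t|) t := by
  rcases eq_or_ne t 0 with rfl | ht
  · rw [hasDerivAt_iff_tendsto_slope]
    have h : Tendsto (fun x : ℝ => |x|) (nhdsWithin 0 {0}ᶜ) (nhds (2 * |0|)) := by
      simpa using (continuous_abs.tendsto (0 : ℝ)).mono_left nhdsWithin_le_nhds
    refine h.congr' ?_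
    filter_upwards [self_mem_nhdsWithin] with x hx
    have hx' : x ≠ 0 := hx
    simp [slope_def_field, hx']
  · refine ((hasDerivAt_id t).mul (hasDerivAt_abs ht)).congr_deriv ?_
    rcases lt_or_gt_of_ne ht with h | h
    · simp [h, abs_of_neg h]; ring
    · simp [h, abs_of_pos h]; ring

theorem phi_eq (u : ℝ) :
    phi u = ((1 - u ^ 2) ^ 3 + (1 - u ^ 2) * ((1 - u ^ 2) * |1 - u ^ 2|)) / 2 := by
  unfold phi
  split_ifs with h
  · have h' : 0 ≤ 1 - u ^ 2 := by nlinarith [abs_nonneg u, sq_abs u]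
    rw [abs_of_nonneg h']
    ring
  · have h' : 1 - u ^ 2 ≤ 0 := by nlinarith [abs_nonneg u, sq_abs u]
    rw [abs_of_nonpos h']
    ring

/-- The derivative of `u ↦ φ(u) u |u|`. -/
noncomputable def phiMulDeriv (u : ℝ) : ℝ :=
  if |u| ≤ 1 then 2 * |u| * ((1 - u ^ 2) ^ 2 * (1 - 4 * u ^ 2)) else 0

theorem hasDerivAt_phi_mul (u : ℝ) :
    HasDerivAt (fun x : ℝ => phi x * (x * |x|)) (phiMulDeriv u) u := by
  have hq : HasDerivAt (fun x : ℝ => 1 - x ^ 2) (-(2 * u)) u := by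
    simpa using (hasDerivAt_pow 2 u).const_sub 1
  have hp := (((hq.pow 3).add (hq.mul ((hasDerivAt_mul_abs_self (1 - u ^ 2)).comp u hq))).div_const
    2).mul (hasDerivAt_mul_abs_self u)
  have hf : (fun x : ℝ => phi x * (x * |x|)) = fun x : ℝ =>
      ((1 - x ^ 2) ^ 3 + (1 - x ^ 2) * ((1 - x ^ 2) * |1 - x ^ 2|)) / 2 * (x * |x|) := by
    funext x
    rw [phi_eq]
  rw [hf]
  refine hp.congr_deriv ?_
  simp only [phiMulDeriv, Pi.add_apply, Pi.mul_apply, Pi.pow_apply, Function.comp_apply]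
  split_ifs with h
  · have h' : 0 ≤ 1 - u ^ 2 := by nlinarith [abs_nonneg u, sq_abs u]
    rw [abs_of_nonneg h']
    push_cast
    ring
  · have h' : 1 - u ^ 2 ≤ 0 := by nlinarith [abs_nonneg u, sq_abs u]
    rw [abs_of_nonpos h']
    push_cast
    ring

theorem abs_phiMulDeriv_le (u : ℝ) : |phiMulDeriv u| ≤ 2 := by
  unfold phiMulDeriv
  split_ifs with h
  · have hs : 0 ≤ u ^ 2 := sq_nonneg u
    have hs1 : u ^ 2 ≤ 1 := by nlinarith [abs_nonneg u, sq_abs u]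
    have hb : |(1 - u ^ 2) ^ 2 * (1 - 4 * u ^ 2)| ≤ 1 := by
      generalize u ^ 2 = s at hs hs1
      have h4 : (1 - s) * (4 * s - 1) ≤ 1 := by nlinarith [sq_nonneg (2 * s - 1)]
      have hsq : (1 - s) ^ 2 ≤ 1 := by nlinarith
      rw [abs_le]
      constructor
      · nlinarith [mul_le_mul_of_nonneg_left h4 (sub_nonneg.2 hs1)]
      · nlinarith [mul_nonneg (sq_nonneg (1 - s)) hs]
    rw [abs_mul, abs_of_nonneg (by positivity : 0 ≤ 2 * |u|)]
    nlinarith [abs_nonneg u, abs_nonneg ((1 - u ^ 2) ^ 2 * (1 - 4 * u ^ 2))]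
  · simp

theorem abs_lt_one_of_phiMulDeriv_ne_zero {u : ℝ} (h : phiMulDeriv u ≠ 0) : |u| < 1 := by
  by_contra hu
  refine h ?_
  unfold phiMulDeriv
  split_ifs with h1
  · have h2 : |u| = 1 := le_antisymm h1 (not_lt.1 hu)
    have h3 : u ^ 2 = 1 := by rw [← sq_abs, h2, one_pow]
    rw [h3]
    ring
  · rfl

theorem hasDerivAt_phi_scaled (ζ u : ℝ) {c : ℝ} (hc : 0 < c) :
    HasDerivAt (fun x : ℝ => phi ((x - ζ) / c) * ((x - ζ) * |x - ζ|))
      (c * phiMulDeriv ((u - ζ) / c)) u := by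
  have hl : HasDerivAt (fun x : ℝ => (x - ζ) / c) (1 / c) u :=
    ((hasDerivAt_id u).sub_const ζ).div_const c
  have h := ((hasDerivAt_phi_mul ((u - ζ) / c)).comp u hl).const_mul (c ^ 2)
  have hf : (fun x : ℝ => phi ((x - ζ) / c) * ((x - ζ) * |x - ζ|)) = fun x : ℝ =>
      c ^ 2 * ((fun x : ℝ => phi x * (x * |x|)) ∘ fun x : ℝ => (x - ζ) / c) x := by
    funext x
    simp only [Function.comp_apply, abs_div, abs_of_pos hc]
    field_simp
  rw [hf]
  refine h.congr_deriv ?_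
  field_simp

theorem two_mul_lt_sub_of_consecutive {k : ℕ} {ζ : Fin k → ℝ} (hζ : StrictMono ζ) {c : ℝ}
    (hsep : ∀ (j : ℕ) (h : j + 1 < k), c < (ζ ⟨j + 1, h⟩ - ζ ⟨j, Nat.lt_of_succ_lt h⟩) / 2)
    {i j : Fin k} (hij : i < j) : 2 * c < ζ j - ζ i := by
  have hlt : i.1 + 1 ≤ j.1 := hij
  have h1 : i.1 + 1 < k := lt_of_le_of_lt hlt j.2
  have h2 : ζ ⟨i.1 + 1, h1⟩ ≤ ζ j := hζ.monotone hlt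
  have h3 := hsep i.1 h1
  have h4 : ζ ⟨i.1, i.2⟩ = ζ i := rfl
  linarith

theorem abs_sum_phiMulDeriv_le {k : ℕ} {ζ α : Fin k → ℝ} {c : ℝ} (hc : 0 < c)
    (hα : ∀ j : Fin k, α j ≠ 0 → c < 1 / (6 * |α j|))
    (hsep : ∀ i j : Fin k, i < j → 2 * c < ζ j - ζ i) (x : ℝ) :
    |∑ j : Fin k, α j * (c * phiMulDeriv ((x - ζ j) / c))| ≤ 1 / 3 := by
  by_cases hex : ∃ j, phiMulDeriv ((x - ζ j) / c) ≠ 0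
  · obtain ⟨j, hj⟩ := hex
    have near : ∀ i, phiMulDeriv ((x - ζ i) / c) ≠ 0 → |x - ζ i| < c := by
      intro i hi
      have h := abs_lt_one_of_phiMulDeriv_ne_zero hi
      rwa [abs_div, abs_of_pos hc, div_lt_one hc] at h
    rw [Finset.sum_eq_single j]
    · rcases eq_or_ne (α j) 0 with h0 | h0
      · rw [h0]
        norm_num
      · have hpos : 0 < |α j| := abs_pos.2 h0
        have hlt := hα j h0
        rw [lt_div_iff₀ (by positivity)] at hlt
        rw [abs_mul, abs_mul, abs_of_pos hc]
        have hb := mul_le_mul_of_nonneg_left (abs_phiMulDeriv_le ((x - ζ j) / c))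
          (mul_pos hpos hc).le
        nlinarith
    · intro i _ hij
      by_contra hne
      have hi : phiMulDeriv ((x - ζ i) / c) ≠ 0 := by
        intro h
        simp [h] at hne
      have hxi := abs_lt.1 (near i hi)
      have hxj := abs_lt.1 (near j hj)
      rcases lt_or_gt_of_ne hij with h | h
      · linarith [hsep _ _ h]
      · linarith [hsep _ _ h]
    · simp
  · push Not at hex
    simp only [hex, mul_zero, Finset.sum_const_zero, abs_zero]
    norm_num

theorem abs_Gfun_sub_id_sub_le {k : ℕ} {ζ α : Fin k → ℝ} {c : ℝ} (hc : 0 < c)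
    (hα : ∀ j : Fin k, α j ≠ 0 → c < 1 / (6 * |α j|))
    (hsep : ∀ i j : Fin k, i < j → 2 * c < ζ j - ζ i) (a b : ℝ) :
    |(Gfun k ζ α c a - a) - (Gfun k ζ α c b - b)| ≤ 1 / 3 * |a - b| := by
  have hd : ∀ x : ℝ, HasDerivAt (fun x : ℝ => Gfun k ζ α c x - x)
      (∑ j : Fin k, α j * (c * phiMulDeriv ((x - ζ j) / c))) x := by
    intro x
    simp only [Gfun, add_sub_cancel_left]
    exact HasDerivAt.fun_sum fun j _ => (hasDerivAt_phi_scaled (ζ j) x hc).const_mul (α j)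
  exact convex_univ.norm_image_sub_le_of_norm_hasDerivWithin_le
    (fun x _ => (hd x).hasDerivWithinAt) (fun x _ => abs_sum_phiMulDeriv_le hc hα hsep x)
    (mem_univ b) (mem_univ a)

/-- The transformed jump coefficient `ρ̃(x) = G(G⁻¹(x) + 1) − x` is Lipschitz continuous on `ℝ`. -/
theorem stmt15 (k : ℕ) (ζ α : Fin k → ℝ) (hζ : StrictMono ζ) (c : ℝ) (hc : 0 < c)
    (hα : ∀ j : Fin k, α j ≠ 0 → c < 1 / (6 * |α j|))
    (hsep : ∀ (j : ℕ) (h : j + 1 < k), c < (ζ ⟨j + 1, h⟩ - ζ ⟨j, by omega⟩) / 2)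
    (Ginv : ℝ → ℝ) (hGinv₁ : Function.LeftInverse Ginv (Gfun k ζ α c))
    (hGinv₂ : Function.RightInverse Ginv (Gfun k ζ α c)) :
    ∃ K : NNReal, LipschitzWith K (fun x : ℝ => Gfun k ζ α c (Ginv x + 1) - x) := by
  refine ⟨1, LipschitzWith.of_dist_le_mul fun x y => ?_⟩
  have hG := abs_Gfun_sub_id_sub_le hc hα
    fun _ _ => two_mul_lt_sub_of_consecutive hζ hsep
  have h1 := hG (Ginv x) (Ginv y)
  have h2 := hG (Ginv x + 1) (Ginv y + 1)
  rw [hGinv₂ x, hGinv₂ y] at h1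
  rw [add_sub_add_right_eq_sub] at h2
  rw [Real.dist_eq, Real.dist_eq, NNReal.coe_one, one_mul]
  generalize Gfun k ζ α c (Ginv x + 1) = p at *
  generalize Gfun k ζ α c (Ginv y + 1) = q at *
  generalize Ginv x = a at *
  generalize Ginv y = b at *
  have h3 : |a - b| ≤ |x - y| + |x - a - (y - b)| := by
    have h := abs_sub (x - y) (x - a - (y - b))
    rwa [show x - y - (x - a - (y - b)) = a - b by ring] at h
  have h4 : |p - x - (q - y)| ≤ |p - (a + 1) - (q - (b + 1))| + |x - a - (y - b)| := by
    have h := abs_sub (p - (a + 1) - (q - (b + 1))) (x - a - (y - b))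
    rwa [show p - (a + 1) - (q - (b + 1)) - (x - a - (y - b)) = p - x - (q - y) by ring] at h
  linarith
end
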